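/- arXiv:1906.05066 — 2 statements merged into one kernel-verified Lean document; each statement's English description precedes it below -/
import Mathlib

section
/- Let C be a finite satisfiable set of linear atomic constraints over a finite set of arguments 𝒜 and let P be a probability function over 𝒜. Then there is a unique probability function P* ∈ u_At(P,C) minimizing the least-squares distance ∑_{w ∈ Ω} (P(w) − P*(w))² over u_At(P,C), and this P* satisfies C (Success of the two-stage least-squares update operator 𝒰²_At). -/
open Finset

/-- A probability function over the possible worlds `Ω = 2^𝒜` (represented as `Finset α`):
maps each world into `[0,1]` and sums to `1`. -/
def IsProbFun {α : Type*} [Fintype α] (P : Finset α → ℝ) : Prop :=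
  (∀ w, 0 ≤ P w ∧ P w ≤ 1) ∧ ∑ w : Finset α, P w = 1

/-- The probability of an argument `A` under `P`: the sum of the probabilities of all
worlds accepting `A`. -/
def argProb {α : Type*} [Fintype α] [DecidableEq α] (P : Finset α → ℝ) (A : α) : ℝ :=
  ∑ w : Finset α, if A ∈ w then P w else 0

/-- A probability function satisfies the linear atomic constraint `c = ((c_A)_A, c₀)`
iff `∑_A c_A · P(A) ≤ c₀`. -/
def SatP {α : Type*} [Fintype α] [DecidableEq α] (P : Finset α → ℝ)
    (c : (α → ℚ) × ℚ) : Prop :=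
  ∑ A : α, (c.1 A : ℝ) * argProb P A ≤ (c.2 : ℝ)

/-- `sat_Π(C)`: the set of probability functions satisfying every constraint in `C`. -/
def satPi {α : Type*} [Fintype α] [DecidableEq α] (C : Finset ((α → ℚ) × ℚ)) :
    Set (Finset α → ℝ) :=
  {P | IsProbFun P ∧ ∀ c ∈ C, SatP P c}

/-- The atomic least-squares distance `d²_At`. -/
def dAt {α : Type*} [Fintype α] [DecidableEq α] (P P' : Finset α → ℝ) : ℝ :=
  ∑ A : α, (argProb P A - argProb P' A) ^ 2

/-- `u_At(P,C)`: the ALS-distance minimizers to `P` within `sat_Π(C)`. -/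
def uAt {α : Type*} [Fintype α] [DecidableEq α] (P : Finset α → ℝ)
    (C : Finset ((α → ℚ) × ℚ)) : Set (Finset α → ℝ) :=
  {P' ∈ satPi C | ∀ Q ∈ satPi C, dAt P P' ≤ dAt P Q}

/-- The (world-wise) least-squares distance `∑_{w ∈ Ω} (P(w) - P'(w))²`. -/
def wDist {α : Type*} [Fintype α] (P P' : Finset α → ℝ) : ℝ :=
  ∑ w : Finset α, (P w - P' w) ^ 2

/-- A probability labelling: maps each argument into `[0,1]`. -/
def IsLab {α : Type*} (L : α → ℝ) : Prop := ∀ A, 0 ≤ L A ∧ L A ≤ 1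

/-- A probability labelling satisfies the linear atomic constraint `c = ((c_A)_A, c₀)`
iff `∑_A c_A · L(A) ≤ c₀`. -/
def SatL {α : Type*} [Fintype α] (L : α → ℝ) (c : (α → ℚ) × ℚ) : Prop :=
  ∑ A : α, (c.1 A : ℝ) * L A ≤ (c.2 : ℝ)

/-- `sat_Λ(C)`: the set of probability labellings satisfying every constraint in `C`. -/
def satLam {α : Type*} [Fintype α] (C : Finset ((α → ℚ) × ℚ)) : Set (α → ℝ) :=
  {L | IsLab L ∧ ∀ c ∈ C, SatL L c}

theorem continuous_argProb {α : Type*} [Fintype α] [DecidableEq α] (A : α) :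
    Continuous fun P : Finset α → ℝ => argProb P A := by
  unfold argProb
  refine continuous_finsetSum _ fun w _ => ?_
  split_ifs
  · exact continuous_apply w
  · exact continuous_const

theorem argProb_midpoint {α : Type*} [Fintype α] [DecidableEq α] (Q R : Finset α → ℝ) (A : α) :
    argProb (fun w => (Q w + R w) / 2) A = (argProb Q A + argProb R A) / 2 := by
  unfold argProb
  rw [← sum_add_distrib, sum_div]
  refine sum_congr rfl fun w _ => ?_
  split_ifs <;> simp

theorem continuous_dAt {α : Type*} [Fintype α] [DecidableEq α] (P : Finset α → ℝ) :
    Continuous (dAt P) :=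
  continuous_finsetSum _ fun A _ => (continuous_const.sub (continuous_argProb A)).pow 2

theorem continuous_wDist {α : Type*} [Fintype α] (P : Finset α → ℝ) :
    Continuous (wDist P) :=
  continuous_finsetSum _ fun w _ => (continuous_const.sub (continuous_apply w)).pow 2

theorem isCompact_satPi {α : Type*} [Fintype α] [DecidableEq α] (C : Finset ((α → ℚ) × ℚ)) :
    IsCompact (satPi C) := by
  have hbox : IsCompact (Set.univ.pi fun _ : Finset α => Set.Icc (0 : ℝ) 1) :=
    isCompact_univ_pi fun _ => isCompact_Icc
  have hsum : IsClosed {P : Finset α → ℝ | ∑ w, P w = 1} :=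
    isClosed_eq (continuous_finsetSum _ fun w _ => continuous_apply w) continuous_const
  have hsat : IsClosed {P : Finset α → ℝ | ∀ c ∈ C, SatP P c} := by
    simp only [Set.ofPred_forall]
    refine isClosed_iInter fun c => isClosed_iInter fun _ => ?_
    exact isClosed_le
      (continuous_finsetSum _ fun A _ => continuous_const.mul (continuous_argProb A))
      continuous_const
  convert (hbox.inter_right hsum).inter_right hsat using 1
  ext P
  simp only [satPi, IsProbFun, Set.mem_inter_iff, Set.mem_univ_pi, Set.mem_Icc, Set.mem_ofPred_eq]

theorem midpoint_mem_satPi {α : Type*} [Fintype α] [DecidableEq α] {C : Finset ((α → ℚ) × ℚ)}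
    {Q R : Finset α → ℝ} (hQ : Q ∈ satPi C) (hR : R ∈ satPi C) :
    (fun w => (Q w + R w) / 2) ∈ satPi C := by
  refine ⟨⟨fun w => ?_, ?_⟩, fun c hc => ?_⟩
  · have hq := hQ.1.1 w
    have hr := hR.1.1 w
    constructor <;> linarith
  · rw [← sum_div, sum_add_distrib, hQ.1.2, hR.1.2]
    norm_num
  · have hq := hQ.2 c hc
    have hr := hR.2 c hc
    unfold SatP at *
    have heq : ∑ A, (c.1 A : ℝ) * argProb (fun w => (Q w + R w) / 2) A
        = (∑ A, (c.1 A : ℝ) * argProb Q A + ∑ A, (c.1 A : ℝ) * argProb R A) / 2 := by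
      rw [← sum_add_distrib, sum_div]
      refine sum_congr rfl fun A _ => ?_
      rw [argProb_midpoint]
      ring
    linarith

theorem dAt_midpoint_le {α : Type*} [Fintype α] [DecidableEq α] (P Q R : Finset α → ℝ) :
    dAt P (fun w => (Q w + R w) / 2) ≤ (dAt P Q + dAt P R) / 2 := by
  unfold dAt
  rw [← sum_add_distrib, sum_div]
  refine sum_le_sum fun A _ => ?_
  rw [argProb_midpoint]
  nlinarith [sq_nonneg (argProb Q A - argProb R A)]

theorem wDist_midpoint {α : Type*} [Fintype α] (P Q R : Finset α → ℝ) :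
    wDist P (fun w => (Q w + R w) / 2) = (wDist P Q + wDist P R) / 2 - wDist Q R / 4 := by
  unfold wDist
  rw [← sum_add_distrib, sum_div, sum_div, ← sum_sub_distrib]
  exact sum_congr rfl fun w _ => by ring

theorem eq_of_wDist_nonpos {α : Type*} [Fintype α] {Q R : Finset α → ℝ} (h : wDist Q R ≤ 0) :
    Q = R := by
  have hnonneg : ∀ w ∈ univ, 0 ≤ (Q w - R w) ^ 2 := fun w _ => sq_nonneg _
  have hzero := (sum_eq_zero_iff_of_nonneg hnonneg).1 (le_antisymm h (sum_nonneg hnonneg))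
  funext w
  exact sub_eq_zero.1 (pow_eq_zero_iff two_ne_zero |>.1 (hzero w (mem_univ w)))

theorem midpoint_mem_uAt {α : Type*} [Fintype α] [DecidableEq α] {C : Finset ((α → ℚ) × ℚ)}
    {P Q R : Finset α → ℝ} (hQ : Q ∈ uAt P C) (hR : R ∈ uAt P C) :
    (fun w => (Q w + R w) / 2) ∈ uAt P C := by
  refine ⟨midpoint_mem_satPi hQ.1 hR.1, fun S hS => ?_⟩
  linarith [dAt_midpoint_le P Q R, hQ.2 S hS, hR.2 S hS]

theorem isCompact_uAt {α : Type*} [Fintype α] [DecidableEq α] (P : Finset α → ℝ)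
    (C : Finset ((α → ℚ) × ℚ)) : IsCompact (uAt P C) := by
  have hclosed : IsClosed {P' | ∀ Q ∈ satPi C, dAt P P' ≤ dAt P Q} := by
    simp only [Set.ofPred_forall]
    exact isClosed_iInter fun Q => isClosed_iInter fun _ =>
      isClosed_le (continuous_dAt P) continuous_const
  exact (isCompact_satPi C).inter_right hclosed

theorem uAt_nonempty {α : Type*} [Fintype α] [DecidableEq α] (P : Finset α → ℝ)
    {C : Finset ((α → ℚ) × ℚ)} (hC : (satPi C).Nonempty) : (uAt P C).Nonempty := by
  obtain ⟨Q, hQ, hmin⟩ :=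
    (isCompact_satPi C).exists_isMinOn hC (continuous_dAt P).continuousOn
  exact ⟨Q, hQ, fun R hR => hmin hR⟩

/-- Success: for satisfiable `C` there is a unique `P* ∈ u_At(P,C)`
minimizing the world-wise least-squares distance to `P` over `u_At(P,C)`, and this `P*`
satisfies `C`. -/
theorem two_stage_update_success {α : Type*} [Fintype α] [DecidableEq α]
    (C : Finset ((α → ℚ) × ℚ)) (hC : (satPi C).Nonempty)
    (P : Finset α → ℝ) (hP : IsProbFun P) :
    ∃ Pstar : Finset α → ℝ,
      (Pstar ∈ uAt P C ∧ ∀ Q ∈ uAt P C, wDist P Pstar ≤ wDist P Q) ∧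
      (∀ c ∈ C, SatP Pstar c) ∧
      (∀ Q : Finset α → ℝ,
        (Q ∈ uAt P C ∧ ∀ Q' ∈ uAt P C, wDist P Q ≤ wDist P Q') → Q = Pstar) := by
  obtain ⟨R, hR, hmin⟩ :=
    (isCompact_uAt P C).exists_isMinOn (uAt_nonempty P hC) (continuous_wDist P).continuousOn
  refine ⟨R, ⟨hR, fun Q hQ => hmin hQ⟩, hR.1.2, fun Q ⟨hQ, hQmin⟩ => eq_of_wDist_nonpos ?_⟩
  have hmid := midpoint_mem_uAt hQ hR
  have hRmid : wDist P R ≤ wDist P (fun w => (Q w + R w) / 2) := hmin hmid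
  linarith [hQmin _ hmid, wDist_midpoint P Q R]
end

section
/- Let C be a finite satisfiable set of linear atomic constraints over a finite set of arguments 𝒜, let L be a probability labelling over 𝒜, and let L* be the unique minimizer of ∑_{A ∈ 𝒜} (L(A) − L'(A))² over L' ∈ sat_Λ(C). Then for every probability function P with P(A) = L(A) for all A ∈ 𝒜, the two-stage least-squares update P* = 𝒰²_At(P,C) satisfies P*(A) = L*(A) for all A ∈ 𝒜. In other words, LU²_λ(L,C) = r([𝒰²_At(P,C)]) for all P ∈ r⁻¹(L). -/
open Finset

/-- The product probability function in which every argument `A` is accepted independently with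
probability `L A`. -/
def indepProb {α : Type*} [Fintype α] [DecidableEq α] (L : α → ℝ) (w : Finset α) : ℝ :=
  (∏ A ∈ w, L A) * ∏ A ∈ univ \ w, (1 - L A)

theorem isProbFun_indepProb {α : Type*} [Fintype α] [DecidableEq α] {L : α → ℝ}
    (hL : IsLab L) : IsProbFun (indepProb L) := by
  have h0 : ∀ A, 0 ≤ 1 - L A := fun A => sub_nonneg.2 (hL A).2
  refine ⟨fun w => ⟨?_, ?_⟩, ?_⟩
  · exact mul_nonneg (prod_nonneg fun A _ => (hL A).1) (prod_nonneg fun A _ => h0 A)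
  · exact mul_le_one₀ (prod_le_one (fun A _ => (hL A).1) fun A _ => (hL A).2)
      (prod_nonneg fun A _ => h0 A)
      (prod_le_one (fun A _ => h0 A) fun A _ => by linarith [(hL A).1])
  · have h := prod_add L (fun A => 1 - L A) univ
    simp only [powerset_univ, add_sub_cancel, prod_const_one] at h
    exact h.symm

theorem argProb_indepProb {α : Type*} [Fintype α] [DecidableEq α] (L : α → ℝ) (A : α) :
    argProb (indepProb L) A = L A := by
  have h := prod_add L (Function.update (fun B => 1 - L B) A 0) univ
  rw [powerset_univ] at h
  have hl : ∏ B, (L B + Function.update (fun B => 1 - L B) A 0 B) = L A := by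
    rw [prod_eq_single A]
    · simp
    · intro B _ hB
      simp [hB]
    · simp
  rw [hl] at h
  rw [h, argProb]
  refine sum_congr rfl fun w _ => ?_
  split_ifs with hw
  · rw [indepProb]
    congr 1
    refine prod_congr rfl fun B hB => ?_
    rw [Function.update_of_ne]
    rintro rfl
    exact (mem_sdiff.1 hB).2 hw
  · rw [prod_eq_zero (s := univ \ w) (i := A) (by simp [hw]) (by simp), mul_zero]

theorem IsProbFun.isLab_argProb {α : Type*} [Fintype α] [DecidableEq α] {P : Finset α → ℝ}
    (hP : IsProbFun P) : IsLab (argProb P) := by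
  refine fun A => ⟨sum_nonneg fun w _ => ?_, ?_⟩
  · split_ifs
    exacts [(hP.1 w).1, le_rfl]
  · rw [← hP.2]
    refine sum_le_sum fun w _ => ?_
    split_ifs
    exacts [le_rfl, (hP.1 w).1]

theorem argProb_mem_satLam {α : Type*} [Fintype α] [DecidableEq α]
    {C : Finset ((α → ℚ) × ℚ)} {P : Finset α → ℝ} (hP : P ∈ satPi C) :
    argProb P ∈ satLam C :=
  ⟨hP.1.isLab_argProb, hP.2⟩

theorem indepProb_mem_satPi {α : Type*} [Fintype α] [DecidableEq α]
    {C : Finset ((α → ℚ) × ℚ)} {L : α → ℝ} (hL : L ∈ satLam C) :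
    indepProb L ∈ satPi C := by
  refine ⟨isProbFun_indepProb hL.1, fun c hc => ?_⟩
  simpa only [SatP, SatL, argProb_indepProb] using hL.2 c hc

theorem midpoint_mem_satLam {α : Type*} [Fintype α]
    {C : Finset ((α → ℚ) × ℚ)} {L L' : α → ℝ} (hL : L ∈ satLam C) (hL' : L' ∈ satLam C) :
    (fun A => (L A + L' A) / 2) ∈ satLam C := by
  refine ⟨fun A => ?_, fun c hc => ?_⟩
  · have h := hL.1 A
    have h' := hL'.1 A
    constructor <;> linarith
  · have h : ∑ A, (c.1 A : ℝ) * L A ≤ c.2 := hL.2 c hc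
    have h' : ∑ A, (c.1 A : ℝ) * L' A ≤ c.2 := hL'.2 c hc
    have e : ∑ A, (c.1 A : ℝ) * ((L A + L' A) / 2)
        = (∑ A, (c.1 A : ℝ) * L A + ∑ A, (c.1 A : ℝ) * L' A) / 2 := by
      rw [← sum_add_distrib, sum_div]
      exact sum_congr rfl fun A _ => by ring
    rw [SatL, e]
    linarith

/-- The least-squares projection of a labelling onto `sat_Λ(C)` is unique. -/
theorem eq_of_le_of_forall_satLam_le {α : Type*} [Fintype α]
    {C : Finset ((α → ℚ) × ℚ)} {L M N : α → ℝ} (hM : M ∈ satLam C) (hN : N ∈ satLam C)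
    (hmin : ∀ L' ∈ satLam C, ∑ A, (L A - M A) ^ 2 ≤ ∑ A, (L A - L' A) ^ 2)
    (hNM : ∑ A, (L A - N A) ^ 2 ≤ ∑ A, (L A - M A) ^ 2) (A : α) : N A = M A := by
  have hmid := hmin _ (midpoint_mem_satLam hM hN)
  have e : ∑ A, (L A - (M A + N A) / 2) ^ 2
      = (∑ A, (L A - M A) ^ 2 + ∑ A, (L A - N A) ^ 2) / 2 - (∑ A, (N A - M A) ^ 2) / 4 := by
    rw [← sum_add_distrib, sum_div, sum_div, ← sum_sub_distrib]
    exact sum_congr rfl fun A _ => by ring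
  have hA : (N A - M A) ^ 2 ≤ ∑ A, (N A - M A) ^ 2 :=
    single_le_sum (f := fun A => (N A - M A) ^ 2) (fun B _ => sq_nonneg _) (mem_univ A)
  have hsq : (N A - M A) ^ 2 = 0 := le_antisymm (by linarith) (sq_nonneg _)
  exact sub_eq_zero.1 (pow_eq_zero_iff two_ne_zero |>.1 hsq)

/-- `LU²_λ(L,C) = r([𝒰²_At(P,C)])` for all `P ∈ r⁻¹(L)`: the labelling
induced by the two-stage least-squares update of any realization `P` of `L` is the
least-squares labelling update `L*` of `L`. -/
theorem labelling_update_matches_two_stage_update {α : Type*} [Fintype α] [DecidableEq α]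
    (C : Finset ((α → ℚ) × ℚ)) (hC : (satPi C).Nonempty)
    (L : α → ℝ) (hL : IsLab L)
    (Lstar : α → ℝ)
    (hLstar : Lstar ∈ satLam C ∧
      ∀ L' ∈ satLam C,
        (∑ A : α, (L A - Lstar A) ^ 2) ≤ ∑ A : α, (L A - L' A) ^ 2)
    (P : Finset α → ℝ) (hP : IsProbFun P) (hPL : ∀ A : α, argProb P A = L A)
    (Pstar : Finset α → ℝ)
    (hPstar : Pstar ∈ uAt P C ∧ ∀ Q ∈ uAt P C, wDist P Pstar ≤ wDist P Q) :
    ∀ A : α, argProb Pstar A = Lstar A := by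
  refine eq_of_le_of_forall_satLam_le hLstar.1 (argProb_mem_satLam hPstar.1.1) hLstar.2 ?_
  simpa only [dAt, argProb_indepProb, hPL] using
    hPstar.1.2 _ (indepProb_mem_satPi hLstar.1)
end
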